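/- arXiv:0712.2254 — 9 statements merged into one kernel-verified Lean document; each statement's English description precedes it below -/
import Mathlib

section
/- Let φ : M → T be a surjective homomorphism of finite monoids, let I be the minimal ideal of M and J the minimal ideal of T, and let e ∈ I be an idempotent. Then φ(e) is an idempotent belonging to J, and φ(G_e) = G_{φ(e)}, i.e., the image under φ of the maximal subgroup of M at e equals the maximal subgroup of T at φ(e). -/
/-- An ideal of a monoid `M`: a nonempty subset closed under left and right
multiplication by arbitrary elements of `M`. -/
def IsIdeal {M : Type*} [Monoid M] (I : Set M) : Prop :=
  I.Nonempty ∧ ∀ m : M, ∀ x ∈ I, m * x ∈ I ∧ x * m ∈ I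

/-- A minimal ideal of a monoid `M`: an ideal contained in every ideal of `M`. -/
def IsMinimalIdeal {M : Type*} [Monoid M] (I : Set M) : Prop :=
  IsIdeal I ∧ ∀ J : Set M, IsIdeal J → I ⊆ J

/-- The maximal subgroup of a monoid `M` at an idempotent `e`: the group of units
of the monoid `eMe` (with identity `e`). -/
def maxSubgroup {M : Type*} [Monoid M] (e : M) : Set M :=
  {x | (∃ m, x = e * m * e) ∧ ∃ y, (∃ m, y = e * m * e) ∧ x * y = e ∧ y * x = e}

/-- In a finite monoid, one-sided inverses relative to an idempotent `e` are two-sided. -/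
theorem mul_eq_idempotent_symm {M : Type*} [Monoid M] [Finite M] {e u v : M}
    (he : e * e = e) (hu : e * u = u) (hu' : u * e = u) (hv : e * v = v)
    (h : u * v = e) : v * u = e := by
  let f : {y : M // e * y = y} → {y : M // e * y = y} :=
    fun y => ⟨u * y, by rw [← mul_assoc, hu]⟩
  have hf : Function.Surjective f := fun y =>
    ⟨⟨v * y, by rw [← mul_assoc, hv]⟩, Subtype.ext <| by
      change u * (v * y.1) = y.1
      rw [← mul_assoc, h, y.2]⟩
  have heq : f ⟨v * u, by rw [← mul_assoc, hv]⟩ = f ⟨e, he⟩ := Subtype.ext <| by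
    change u * (v * u) = u * e
    rw [← mul_assoc, h, hu, hu']
  exact congrArg Subtype.val (Finite.injective_iff_surjective.mpr hf heq)

/-- At an idempotent of the minimal ideal of a finite monoid, all of `eMe` is a group. -/
theorem IsMinimalIdeal.maxSubgroup_eq {M : Type*} [Monoid M] [Finite M] {I : Set M}
    (hI : IsMinimalIdeal I) {e : M} (heI : e ∈ I) (he : e * e = e) :
    maxSubgroup e = {x | ∃ m, x = e * m * e} := by
  refine Set.Subset.antisymm (fun x hx => hx.1) fun x hx => ⟨hx, ?_⟩
  have hideal : IsIdeal {z : M | ∃ a b, z = a * x * b} := by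
    refine ⟨⟨x, 1, 1, by simp⟩, ?_⟩
    rintro m _ ⟨a, b, rfl⟩
    exact ⟨⟨m * a, b, by simp only [mul_assoc]⟩, ⟨a, b * m, by simp only [mul_assoc]⟩⟩
  obtain ⟨a, b, hab⟩ := hI.2 _ hideal heI
  have he' (z : M) : e * (e * z) = e * z := by rw [← mul_assoc, he]
  have hex : e * x = x := by
    obtain ⟨m, rfl⟩ := hx
    simp only [mul_assoc, he']
  have hxe : x * e = x := by
    obtain ⟨m, rfl⟩ := hx
    simp only [mul_assoc, he]
  have hinv : e * a * e * x * (e * b * e) = e := calc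
    _ = e * (a * (e * x) * e * b) * e := by simp only [mul_assoc]
    _ = e * (a * x * b) * e := by rw [hex, mul_assoc a x e, hxe]
    _ = e := by rw [← hab, he, he]
  refine ⟨e * b * e * (e * a * e), ⟨b * e * (e * a), by simp only [mul_assoc]⟩, ?_, ?_⟩
  · rw [← mul_assoc]
    refine mul_eq_idempotent_symm he ?_ ?_ ?_ (by rwa [← mul_assoc])
    · simp only [mul_assoc, he']
    · simp only [mul_assoc, he]
    · rw [← mul_assoc, hex]
  · rw [mul_assoc]
    refine mul_eq_idempotent_symm he ?_ ?_ ?_ hinv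
    · simp only [mul_assoc, he']
    · simp only [mul_assoc, hxe]
    · simp only [mul_assoc, he']

/-- The preimage of an ideal under a surjective homomorphism is an ideal. -/
theorem IsIdeal.preimage {M T : Type*} [Monoid M] [Monoid T] {φ : M →* T}
    (hφ : Function.Surjective φ) {J : Set T} (hJ : IsIdeal J) : IsIdeal (φ ⁻¹' J) := by
  refine ⟨hJ.1.preimage hφ, fun m x hx => ?_⟩
  simpa only [Set.mem_preimage, map_mul] using hJ.2 (φ m) (φ x) hx

/-- If `φ : M → T` is a surjective homomorphism of finite monoids, `I` the minimal
ideal of `M`, `J` the minimal ideal of `T`, and `e ∈ I` is idempotent, then `φ e`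
is an idempotent of `J` and `φ(G_e) = G_{φ e}`. -/
theorem image_maxSubgroup_of_minimalIdeal {M T : Type*} [Monoid M] [Finite M]
    [Monoid T] [Finite T] (φ : M →* T) (hφ : Function.Surjective φ)
    (I : Set M) (J : Set T) (hI : IsMinimalIdeal I) (hJ : IsMinimalIdeal J)
    (e : M) (heI : e ∈ I) (he : e * e = e) :
    φ e * φ e = φ e ∧ φ e ∈ J ∧ φ '' maxSubgroup e = maxSubgroup (φ e) := by
  have hidem : φ e * φ e = φ e := by rw [← map_mul, he]
  have hmem : φ e ∈ J := hI.2 _ (hJ.1.preimage hφ) heI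
  refine ⟨hidem, hmem, ?_⟩
  rw [hI.maxSubgroup_eq heI he, hJ.maxSubgroup_eq hmem hidem]
  ext t
  constructor
  · rintro ⟨_, ⟨m, rfl⟩, rfl⟩
    exact ⟨φ m, by simp only [map_mul]⟩
  · rintro ⟨t, rfl⟩
    obtain ⟨m, rfl⟩ := hφ t
    exact ⟨_, ⟨m, rfl⟩, by simp only [map_mul]⟩
end

section
/- Let G be a group, B a nonempty set, S = G ≀ (B, B̄), and let e = (f, b) ∈ S be an idempotent. Then every element of eSe = {e*s*e : s ∈ S} has second coordinate b, and the map ψ : eSe → G defined by ψ(g, b) = g b is a bijection onto G satisfying ψ(u*v) = ψ(u)*ψ(v) for all u, v ∈ eSe and ψ(e) = 1. In particular eSe is a group with identity e, isomorphic to G. -/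
/-- The multiplication of the wreath product `G ≀ (B, B̄)` of a group `G` with the
semigroup of constant maps on `B`: the underlying set is `(B → G) × B` and
`(f, b) * (g, c) = ((fun x => f x * g b), c)`. -/
def wmul {G B : Type*} [Mul G] (a b : (B → G) × B) : (B → G) × B :=
  (fun x => a.1 x * b.1 a.2, b.2)

theorem wmul_idempotent_apply {G B : Type*} [Group G] {e : (B → G) × B}
    (he : wmul e e = e) : e.1 e.2 = 1 := by
  simpa [wmul] using congrFun (congrArg Prod.fst he) e.2

theorem exists_eq_wmul_wmul_iff {G B : Type*} [Group G] {e : (B → G) × B}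
    (he : wmul e e = e) (z : (B → G) × B) :
    (∃ s, z = wmul (wmul e s) e) ↔ ∃ g : G, z = (fun x => e.1 x * g, e.2) := by
  constructor
  · rintro ⟨s, rfl⟩
    exact ⟨s.1 e.2 * e.1 s.2, by simp [wmul, mul_assoc]⟩
  · rintro ⟨g, rfl⟩
    exact ⟨(fun _ => g, e.2), by simp [wmul, wmul_idempotent_apply he]⟩

/-- Let `e` be an idempotent of `S = G ≀ (B, B̄)`.  Every element of
`eSe = {e*s*e : s ∈ S}` has second coordinate `e.2 = b`, the map
`ψ : eSe → G, (g, b) ↦ g b` is a multiplicative bijection onto `G`, and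
`ψ e = 1`; so `eSe` is a group with identity `e`, isomorphic to `G`. -/
theorem wreath_constant_maps_maxSubgroup {G B : Type*} [Group G] [Nonempty B]
    (e : (B → G) × B) (he : wmul e e = e) :
    e ∈ {z : (B → G) × B | ∃ s, z = wmul (wmul e s) e} ∧
    (∀ u ∈ {z : (B → G) × B | ∃ s, z = wmul (wmul e s) e}, u.2 = e.2) ∧
    Set.BijOn (fun u : (B → G) × B => u.1 e.2)
      {z : (B → G) × B | ∃ s, z = wmul (wmul e s) e} (Set.univ : Set G) ∧
    (∀ u ∈ {z : (B → G) × B | ∃ s, z = wmul (wmul e s) e},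
      ∀ v ∈ {z : (B → G) × B | ∃ s, z = wmul (wmul e s) e},
        (wmul u v).1 e.2 = u.1 e.2 * v.1 e.2) ∧
    e.1 e.2 = 1 := by
  have h_one := wmul_idempotent_apply he
  simp only [exists_eq_wmul_wmul_iff he]
  refine ⟨⟨1, by simp⟩, ?_, ⟨fun _ _ => Set.mem_univ _, ?_, ?_⟩, ?_, h_one⟩
  · rintro _ ⟨g, rfl⟩
    rfl
  · rintro _ ⟨g, rfl⟩ _ ⟨k, rfl⟩ h
    have hgk : g = k := by simpa using h
    rw [hgk]
  · intro g _
    exact ⟨_, ⟨g, rfl⟩, by simp [h_one]⟩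
  · rintro _ ⟨g, rfl⟩ _ ⟨k, rfl⟩
    rfl
end

section
/- Let S be a compact Hausdorff topological monoid (multiplication continuous), let M be a finite monoid, let ψ : S → M be a continuous monoid homomorphism, and let I ⊆ S be a nonempty closed subsemigroup. Then E(ψ(I)) = ψ(E(I)): the idempotents of the image ψ(I) are exactly the images of idempotents of I. -/
/-- Let `S` be a compact Hausdorff topological monoid, `M` a finite (discrete)
monoid, `ψ : S → M` a continuous monoid homomorphism and `I ⊆ S` a nonempty
closed subsemigroup.  Then the idempotents of `ψ(I)` are exactly the images of
the idempotents of `I`: `E(ψ(I)) = ψ(E(I))`. -/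
theorem idempotents_of_image_eq {S M : Type*} [Monoid S] [TopologicalSpace S]
    [CompactSpace S] [T2Space S] [ContinuousMul S]
    [Monoid M] [Finite M] [TopologicalSpace M] [DiscreteTopology M]
    (ψ : S →* M) (hψ : Continuous ψ)
    (I : Set S) (hne : I.Nonempty) (hcl : IsClosed I)
    (hmul : ∀ x ∈ I, ∀ y ∈ I, x * y ∈ I) :
    {m : M | m ∈ ψ '' I ∧ m * m = m} = ψ '' {x : S | x ∈ I ∧ x * x = x} := by
  ext m
  constructor
  · rintro ⟨⟨x, hxI, hxm⟩, hm⟩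
    have hfiber : IsClosed (I ∩ ψ ⁻¹' {m}) :=
      hcl.inter ((isClosed_discrete {m}).preimage hψ)
    obtain ⟨e, ⟨heI, hem⟩, he⟩ := exists_idempotent_in_compact_subsemigroup
      (fun r : S => continuous_mul_const r) (I ∩ ψ ⁻¹' {m}) ⟨x, hxI, hxm⟩ hfiber.isCompact (by
        rintro a ⟨haI, ha⟩ b ⟨hbI, hb⟩
        refine ⟨hmul a haI b hbI, ?_⟩
        simp only [Set.mem_preimage, Set.mem_singleton_iff] at ha hb ⊢
        rw [map_mul, ha, hb, hm])
    exact ⟨e, ⟨heI, he⟩, hem⟩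
  · rintro ⟨x, ⟨hxI, hx⟩, rfl⟩
    exact ⟨⟨x, hxI, rfl⟩, by rw [← map_mul, hx]⟩
end

section
/- In this setting, y is an idempotent of M, and the minimal ideal of M equals {(f, τ) ∈ M : τ is a constant map}. -/
/-- The wreath product `H ≀ (B, T_B)` of a monoid `H` with the full transformation
monoid on `B`: pairs `(f, t)` with `f : B → H`, `t : B → B`, multiplication
`(f, s) * (g, t) = ((fun b => f b * g (s b)), (fun b => t (s b)))`. -/
structure Wreath (H B : Type*) where
  f : B → H
  t : B → B

instance {H B : Type*} [Monoid H] : Monoid (Wreath H B) where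
  mul a b := ⟨fun i => a.f i * b.f (a.t i), fun i => b.t (a.t i)⟩
  one := ⟨fun _ => 1, id⟩
  mul_assoc a b c := by
    show Wreath.mk _ _ = Wreath.mk _ _
    congr 1
    · funext i; exact mul_assoc _ _ _
  one_mul a := by
    show Wreath.mk _ _ = _
    cases a
    congr 1
    funext i; exact one_mul _
  mul_one a := by
    show Wreath.mk _ _ = _
    cases a
    congr 1
    funext i; exact mul_one _

/-- An ideal of the submonoid (viewed as the set `M`) of an ambient monoid:
a nonempty subset `I ⊆ M` with `u * z ∈ I` and `z * u ∈ I` for all `u ∈ M`, `z ∈ I`. -/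
def IsIdealIn {W : Type*} [Monoid W] (M I : Set W) : Prop :=
  I.Nonempty ∧ I ⊆ M ∧ ∀ u ∈ M, ∀ z ∈ I, u * z ∈ I ∧ z * u ∈ I

/-- The minimal ideal: an ideal contained in every ideal. -/
def IsMinimalIdealIn {W : Type*} [Monoid W] (M I : Set W) : Prop :=
  IsIdealIn M I ∧ ∀ J : Set W, IsIdealIn M J → I ⊆ J

namespace Wreath

@[ext]
theorem ext {H B : Type*} {a b : Wreath H B} (hf : a.f = b.f) (ht : a.t = b.t) : a = b := by
  cases a; cases b; simp_all

@[simp]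
theorem mul_mk {H B : Type*} [Monoid H] (f g : B → H) (s t : B → B) :
    (mk f s * mk g t : Wreath H B) = mk (fun b => f b * g (s b)) (fun b => t (s b)) := rfl

theorem one_eq {H B : Type*} [Monoid H] : (1 : Wreath H B) = mk (fun _ => 1) id := rfl

/-- The translation `i ↦ i + c` with trivial group labels. -/
def translation (H : Type*) [Monoid H] {B : Type*} [Add B] (c : B) : Wreath H B :=
  mk (fun _ => 1) (fun i => i + c)

/-- The constant element with value `c`, whose labels are the `a`-translate of `Y`
multiplied on the right by `g`. -/
def const {H B : Type*} [Monoid H] [Add B] (Y : B → H) (a : B) (g : H) (c : B) : Wreath H B :=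
  mk (fun b => Y (b + a) * g) (fun _ => c)

section Monoid

variable {H B : Type*} [Monoid H]

theorem translation_one_pow [AddMonoidWithOne B] (k : ℕ) :
    translation H (1 : B) ^ k = translation H (k : B) := by
  induction k with
  | zero => ext <;> simp [translation, one_eq]
  | succ k ih => rw [pow_succ, ih]; simp [translation, add_assoc]

theorem const_mul_const [AddZeroClass B] (Y : B → H) (a a' c c' : B) (g g' : H) :
    const Y a g c * const Y a' g' c' = const Y a (g * (Y (c + a') * g')) c' := by
  simp [const, mul_assoc]

theorem translation_mul_const [AddMonoid B] (Y : B → H) (a c c' : B) (g : H) :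
    translation H c * const Y a g c' = const Y (c + a) g c' := by
  simp [const, translation, add_assoc]

theorem const_mul_translation [AddZeroClass B] (Y : B → H) (a c c' : B) (g : H) :
    const Y a g c * translation H c' = const Y a g (c + c') := by
  simp [const, translation]

theorem translation_mul_translation [AddMonoid B] (c c' : B) :
    translation H c * translation H c' = translation H (c + c') := by
  simp [translation, add_assoc]

/-- Every element of the submonoid generated by a translation and an element `const Y 0 1 0`
is a translation or one of the elements `const Y a g c`. -/
theorem eq_translation_or_eq_const [AddMonoidWithOne B] (Y : B → H) {z : Wreath H B}
    (hz : z ∈ Submonoid.closure {translation H (1 : B), const Y 0 1 0}) :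
    (∃ c, z = translation H c) ∨ ∃ a g c, z = const Y a g c := by
  induction hz using Submonoid.closure_induction with
  | mem z hz =>
    rcases hz with rfl | rfl
    · exact .inl ⟨_, rfl⟩
    · exact .inr ⟨_, _, _, rfl⟩
  | one => exact .inl ⟨0, by ext <;> simp [translation, one_eq]⟩
  | mul u v _ _ hu hv =>
    rcases hu with ⟨c, rfl⟩ | ⟨a, g, c, rfl⟩ <;> rcases hv with ⟨c', rfl⟩ | ⟨a', g', c', rfl⟩
    · exact .inl ⟨_, translation_mul_translation _ _⟩
    · exact .inr ⟨_, _, _, translation_mul_const _ _ _ _ _⟩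
    · exact .inr ⟨_, _, _, const_mul_translation _ _ _ _ _⟩
    · exact .inr ⟨_, _, _, const_mul_const _ _ _ _ _ _ _⟩

end Monoid

section ZMod

variable {H : Type*} {n : ℕ} [NeZero n]

theorem translation_mem_closure [Monoid H] (y : Wreath H (ZMod n)) (c : ZMod n) :
    translation H c ∈ Submonoid.closure {translation H (1 : ZMod n), y} := by
  rw [← ZMod.natCast_zmod_val c, ← translation_one_pow]
  exact pow_mem (Submonoid.subset_closure (by simp)) _

theorem const_mem_closure [Monoid H] {Y : ZMod n → H} (hY : Y.Surjective) (a : ZMod n) (g : H)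
    (c : ZMod n) :
    const Y a g c ∈ Submonoid.closure {translation H (1 : ZMod n), const Y 0 1 0} := by
  obtain ⟨s, rfl⟩ := hY g
  have key : const Y a (Y s) c = translation H a * const Y 0 1 0 *
      (translation H s * const Y 0 1 0) * translation H c := by
    simp [translation_mul_const, const_mul_const, const_mul_translation]
  have hy : const Y 0 1 0 ∈ Submonoid.closure {translation H (1 : ZMod n), const Y 0 1 0} :=
    Submonoid.subset_closure (by simp)
  rw [key]
  exact mul_mem (mul_mem (mul_mem (translation_mem_closure _ _) hy)
    (mul_mem (translation_mem_closure _ _) hy)) (translation_mem_closure _ _)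

/-- For a surjective labelling `Y` with `Y 0 = 1`, the elements with constant underlying map form
the minimal ideal of the submonoid generated by `translation H 1` and `const Y 0 1 0`. -/
theorem isMinimalIdealIn_constant [Group H] {Y : ZMod n → H} (hY : Y.Surjective)
    (hY0 : Y 0 = 1) :
    IsMinimalIdealIn
      (↑(Submonoid.closure {translation H (1 : ZMod n), const Y 0 1 0}))
      {z | z ∈ Submonoid.closure {translation H (1 : ZMod n), const Y 0 1 0} ∧
        ∃ c : ZMod n, z.t = fun _ => c} := by
  refine ⟨⟨⟨_, const_mem_closure hY 0 1 0, 0, rfl⟩, fun z hz => hz.1, ?_⟩, ?_⟩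
  · rintro u hu z ⟨hz, c, hc⟩
    refine ⟨⟨mul_mem hu hz, c, ?_⟩, mul_mem hz hu, u.t c, ?_⟩
    · change (fun i => z.t (u.t i)) = _
      simp [hc]
    · change (fun i => u.t (z.t i)) = _
      simp [hc]
  · rintro J ⟨⟨z, hz⟩, hJM, hJ⟩ w ⟨hw, d, hd⟩
    obtain ⟨a, g, hzy⟩ : ∃ a g, z * const Y 0 1 0 = const Y a g 0 := by
      rcases eq_translation_or_eq_const Y (hJM hz) with ⟨c, rfl⟩ | ⟨a, g, c, rfl⟩
      · exact ⟨_, _, translation_mul_const _ _ _ _ _⟩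
      · exact ⟨_, _, const_mul_const _ _ _ _ _ _ _⟩
    have hmem : const Y a g 0 ∈ J := hzy ▸ (hJ _ (const_mem_closure hY 0 1 0) _ hz).2
    have hall (a' : ZMod n) (g' : H) (c' : ZMod n) : const Y a' g' c' ∈ J := by
      have key : const Y a' g' c' =
          const Y a' 1 (-a) * const Y a g 0 * const Y 0 (g⁻¹ * g') c' := by
        simp [const_mul_const, hY0]
      rw [key]
      exact (hJ _ (const_mem_closure hY _ _ _) _ (hJ _ (const_mem_closure hY _ _ _) _ hmem).1).2
    rcases eq_translation_or_eq_const Y hw with ⟨c, rfl⟩ | ⟨a', g', c', rfl⟩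
    · have hzero (b : ZMod n) : b = 0 :=
        add_right_cancel ((congrFun hd b).trans (congrFun hd 0).symm)
      convert hall 0 1 c using 1
      ext b
      · simp [translation, const, hzero b, hY0]
      · simp [translation, const, hzero b]
    · exact hall a' g' c'

end ZMod

end Wreath

/-- Let `H` be a finite group of order `m` enumerated by `h : Fin m → H` with
`h 0 = 1`, let `n ≥ 2m - 1`, `n ≥ 1`, and let `M` be the submonoid of the wreath
product `H ≀ (ZMod n, T_{ZMod n})` generated by `x = (1̄, i ↦ i + 1)` and
`y = (Y, 0̄)`.  Then `y` is idempotent and the minimal ideal of `M` is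
`{(f, τ) ∈ M : τ is a constant map}`. -/
theorem minimalIdeal_of_two_generated_wreath {H : Type*} [Group H] [Fintype H]
    (m : ℕ) (hm : m = Fintype.card H) (hm1 : 0 < m)
    (h : Fin m → H) (hbij : Function.Bijective h) (h0 : h ⟨0, hm1⟩ = 1)
    (n : ℕ) (hn1 : 1 ≤ n) (hnm : 2 * m - 1 ≤ n)
    (Y : ZMod n → H)
    (hY : ∀ j : ZMod n, Y j = if hj : j.val < m then h ⟨j.val, hj⟩ else 1)
    (x y : Wreath H (ZMod n))
    (hx : x = ⟨fun _ => 1, fun i => i + 1⟩)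
    (hy : y = ⟨Y, fun _ => (0 : ZMod n)⟩) :
    y * y = y ∧
    IsMinimalIdealIn (↑(Submonoid.closure ({x, y} : Set (Wreath H (ZMod n)))))
      {z : Wreath H (ZMod n) |
        z ∈ Submonoid.closure ({x, y} : Set (Wreath H (ZMod n))) ∧
        ∃ c : ZMod n, z.t = fun _ => c} := by
  subst hx
  have : NeZero n := ⟨by omega⟩
  have hY0 : Y 0 = 1 := by simp [hY, hm1, h0]
  have hsurj : Y.Surjective := fun g => by
    obtain ⟨j, rfl⟩ := hbij.2 g
    have hj : (j.val : ZMod n).val = j.val := ZMod.val_cast_of_lt (by omega)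
    exact ⟨(j.val : ZMod n), by simp [hY, hj]⟩
  obtain rfl : y = Wreath.const Y 0 1 0 := by simp [hy, Wreath.const]
  exact ⟨by simp [Wreath.const_mul_const, hY0], Wreath.isMinimalIdealIn_constant hsurj hY0⟩
end

section
/- In this setting, y is an idempotent of M and the map θ sending an element (f, τ) of the maximal subgroup G_y of M at y to f 0 ∈ H is a group isomorphism from G_y onto H; that is, θ restricted to G_y is bijective onto H and satisfies θ(u*v) = θ(u)*θ(v) and θ(y) = 1. -/
/-- The maximal subgroup of the submonoid (with underlying set `M`) at an
idempotent `e`: the group of units of the monoid `eMe = {e*u*e : u ∈ M}` with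
identity `e`. -/
def maxSubgroupIn {W : Type*} [Monoid W] (M : Set W) (e : W) : Set W :=
  {z | (∃ u ∈ M, z = e * u * e) ∧
    ∃ w, (∃ u ∈ M, w = e * u * e) ∧ z * w = e ∧ w * z = e}

namespace Wreath

variable {H B : Type*} [Monoid H]

@[simp] theorem mul_f (a b : Wreath H B) (i : B) : (a * b).f i = a.f i * b.f (a.t i) := rfl

@[simp] theorem mul_t (a b : Wreath H B) (i : B) : (a * b).t i = b.t (a.t i) := rfl

/-- Sandwiching between two copies of an element whose transformation is constant with value `c`. -/
theorem const_mul_mul_const (Y : B → H) (c : B) (u : Wreath H B) :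
    (⟨Y, fun _ => c⟩ : Wreath H B) * u * ⟨Y, fun _ => c⟩ =
      ⟨fun j => Y j * (u.f c * Y (u.t c)), fun _ => c⟩ :=
  congrArg (Wreath.mk · _) (funext fun _ => mul_assoc _ _ _)

/-- Powers of a pure translation are pure translations. -/
theorem translation_pow [AddMonoidWithOne B] (k : ℕ) :
    (⟨fun _ => 1, fun i => i + 1⟩ : Wreath H B) ^ k = ⟨fun _ => 1, fun i => i + k⟩ := by
  induction k with
  | zero =>
    rw [pow_zero, Nat.cast_zero]
    exact congrArg (Wreath.mk _) (funext fun i => (add_zero i).symm)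
  | succ k ih =>
    rw [pow_succ, ih]
    show Wreath.mk _ _ = Wreath.mk _ _
    simp [add_assoc]

end Wreath

/-- In the two-generated submonoid `M = ⟨x, y⟩` of `H ≀ (ZMod n, T_{ZMod n})`,
`y` is idempotent and the map `θ : (f, τ) ↦ f 0` is a group isomorphism from the
maximal subgroup `G_y` of `M` at `y` onto `H`. -/
theorem maxSubgroup_of_two_generated_wreath {H : Type*} [Group H] [Fintype H]
    (m : ℕ) (hm : m = Fintype.card H) (hm1 : 0 < m)
    (h : Fin m → H) (hbij : Function.Bijective h) (h0 : h ⟨0, hm1⟩ = 1)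
    (n : ℕ) (hn1 : 1 ≤ n) (hnm : 2 * m - 1 ≤ n)
    (Y : ZMod n → H)
    (hY : ∀ j : ZMod n, Y j = if hj : j.val < m then h ⟨j.val, hj⟩ else 1)
    (x y : Wreath H (ZMod n))
    (hx : x = ⟨fun _ => 1, fun i => i + 1⟩)
    (hy : y = ⟨Y, fun _ => (0 : ZMod n)⟩) :
    y * y = y ∧
    Set.BijOn (fun z : Wreath H (ZMod n) => z.f 0)
      (maxSubgroupIn (↑(Submonoid.closure ({x, y} : Set (Wreath H (ZMod n))))) y)
      (Set.univ : Set H) ∧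
    (∀ u ∈ maxSubgroupIn
        (↑(Submonoid.closure ({x, y} : Set (Wreath H (ZMod n))))) y,
      ∀ v ∈ maxSubgroupIn
        (↑(Submonoid.closure ({x, y} : Set (Wreath H (ZMod n))))) y,
        (u * v).f 0 = u.f 0 * v.f 0) ∧
    y.f 0 = 1 := by
  have : NeZero n := ⟨by omega⟩
  have hY0 : Y 0 = 1 := by simp [hY, hm1, h0]
  have hsurj : ∀ a : H, ∃ k : ℕ, Y k = a := fun a => by
    obtain ⟨k, rfl⟩ := hbij.surjective a
    have hk := k.isLt
    exact ⟨k, by simp [hY, ZMod.val_natCast_of_lt (show (k : ℕ) < n by omega)]⟩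
  have hmul : ∀ a b : H, (⟨fun j => Y j * a, fun _ => 0⟩ : Wreath H (ZMod n)) *
      ⟨fun j => Y j * b, fun _ => 0⟩ = ⟨fun j => Y j * (a * b), fun _ => 0⟩ := fun a b => by
    show Wreath.mk _ _ = Wreath.mk _ _
    simp [hY0, mul_assoc]
  have hy1 : y = ⟨fun j => Y j * 1, fun _ => 0⟩ := by simp [hy]
  have hform : ∀ a : H, ∃ u ∈ Submonoid.closure ({x, y} : Set (Wreath H (ZMod n))),
      (⟨fun j => Y j * a, fun _ => 0⟩ : Wreath H (ZMod n)) = y * u * y := fun a => by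
    obtain ⟨k, rfl⟩ := hsurj a
    refine ⟨x ^ k, pow_mem (Submonoid.subset_closure (by simp)) k, ?_⟩
    rw [hx, Wreath.translation_pow, hy, Wreath.const_mul_mul_const]
    simp
  have hmem : ∀ z ∈ maxSubgroupIn
      (↑(Submonoid.closure ({x, y} : Set (Wreath H (ZMod n))))) y,
      z = ⟨fun j => Y j * z.f 0, fun _ => 0⟩ := by
    rintro z ⟨⟨u, -, rfl⟩, -⟩
    rw [hy, Wreath.const_mul_mul_const]
    simp [hY0]
  refine ⟨?_, ⟨fun _ _ => Set.mem_univ _, fun u hu v hv huv => ?_, fun a _ => ?_⟩,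
    fun u hu v _ => ?_, ?_⟩
  · rw [hy1, hmul, mul_one]
  · dsimp only at huv
    rw [hmem u hu, hmem v hv, huv]
  · refine ⟨⟨fun j => Y j * a, fun _ => 0⟩, ⟨hform a, _, hform a⁻¹, ?_, ?_⟩, by simp [hY0]⟩
    · rw [hmul, mul_inv_cancel, hy1]
    · rw [hmul, inv_mul_cancel, hy1]
  · rw [Wreath.mul_f, congrArg (fun z => z.t 0) (hmem u hu)]
  · simp [hy, hY0]
end

section
/- In this setting, every element of the maximal subgroup G_y of M at the idempotent y is a product of finitely many idempotents of M. -/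
namespace Wreath

variable {H : Type*} [Group H]

theorem mk_mul_mk {B : Type*} (f g : B → H) (s t : B → B) :
    (⟨f, s⟩ * ⟨g, t⟩ : Wreath H B) = ⟨fun b => f b * g (s b), fun b => t (s b)⟩ := rfl

theorem shift_pow {n : ℕ} (k : ℕ) :
    (⟨fun _ => 1, fun i => i + 1⟩ : Wreath H (ZMod n)) ^ k
      = ⟨fun _ => 1, fun i => i + (k : ZMod n)⟩ := by
  induction k with
  | zero =>
    rw [pow_zero]
    simp only [Nat.cast_zero, add_zero]
    rfl
  | succ k ih =>
    rw [pow_succ, ih, mk_mul_mk]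
    simp [add_assoc]

/-- If `Y 0 = 1` and `Y a = 1` or `Y (-a) = 1` for every `a`, then each `y * x ^ k * y` is a product
of idempotents of the monoid generated by `x` and `y`. -/
theorem mul_shift_pow_mul_mem_closure {n : ℕ} [NeZero n] {Y : ZMod n → H} (hY0 : Y 0 = 1)
    (hY : ∀ a, Y a = 1 ∨ Y (-a) = 1) {x y : Wreath H (ZMod n)}
    (hx : x = ⟨fun _ => 1, fun i => i + 1⟩) (hy : y = ⟨Y, fun _ => 0⟩) (k : ℕ) :
    y * x ^ k * y ∈
      Submonoid.closure {w | w ∈ Submonoid.closure ({x, y} : Set (Wreath H (ZMod n))) ∧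
        w * w = w} := by
  have hxM : x ∈ Submonoid.closure ({x, y} : Set (Wreath H (ZMod n))) :=
    Submonoid.subset_closure (by simp)
  have hyM : y ∈ Submonoid.closure ({x, y} : Set (Wreath H (ZMod n))) :=
    Submonoid.subset_closure (by simp)
  have hyS : y ∈ Submonoid.closure {w | w ∈ Submonoid.closure ({x, y} : Set _) ∧ w * w = w} :=
    Submonoid.subset_closure ⟨hyM, by simp [hy, mk_mul_mk, hY0]⟩
  rcases hY (k : ZMod n) with hk | hk
  · have : y * x ^ k * y = y := by
      rw [hx, shift_pow, hy]
      simp [mk_mul_mk, hk]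
    rwa [this]
  · have hfactor : y * x ^ k * y = y * (x ^ k * y * x ^ (-(k : ZMod n)).val) * y := by
      rw [hx, shift_pow, shift_pow, hy]
      simp [mk_mul_mk, hk]
    rw [hfactor]
    refine mul_mem (mul_mem hyS (Submonoid.subset_closure ⟨?_, ?_⟩)) hyS
    · exact mul_mem (mul_mem (pow_mem hxM _) hyM) (pow_mem hxM _)
    · rw [hx, shift_pow, shift_pow, hy]
      simp [mk_mul_mk, hY0]

end Wreath

/-- If `y` is idempotent and every `y * x ^ k * y` lies in a submonoid `S`, then so does
`y * u * y` for every `u` in the monoid generated by `x` and `y`. -/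
theorem mul_mul_mem_of_mul_pow_mul_mem {W : Type*} [Monoid W] {x y : W} {S : Submonoid W}
    (hyy : y * y = y) (hS : ∀ k : ℕ, y * x ^ k * y ∈ S) {u : W}
    (hu : u ∈ Submonoid.closure {x, y}) : y * u * y ∈ S := by
  have key : ∃ s ∈ S, s * y = s ∧ ∃ k : ℕ, y * u = s * x ^ k := by
    induction hu using Submonoid.closure_induction_right with
    | one => exact ⟨y, by simpa [hyy] using hS 0, hyy, 0, by simp⟩
    | mul_right u _ v hv ih =>
      obtain ⟨s, hs, hsy, k, hk⟩ := ih
      rcases hv with rfl | rfl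
      · exact ⟨s, hs, hsy, k + 1, by rw [← mul_assoc, hk, pow_succ, mul_assoc]⟩
      · refine ⟨s * (v * x ^ k * v), mul_mem hs (hS k), by simp only [mul_assoc, hyy], 0, ?_⟩
        rw [← mul_assoc, hk, pow_zero, mul_one, ← mul_assoc, ← mul_assoc, hsy]
  obtain ⟨s, hs, hsy, k, hk⟩ := key
  have : y * u * y = s * (y * x ^ k * y) := by
    rw [hk, ← mul_assoc, ← mul_assoc, hsy]
  exact this ▸ mul_mem hs (hS k)

/-- In the two-generated submonoid `M = ⟨x, y⟩` of `H ≀ (ZMod n, T_{ZMod n})`,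
every element of the maximal subgroup `G_y` of `M` at the idempotent `y` is a
product of finitely many idempotents of `M`. -/
theorem maxSubgroup_generated_by_idempotents {H : Type*} [Group H] [Fintype H]
    (m : ℕ) (hm : m = Fintype.card H) (hm1 : 0 < m)
    (h : Fin m → H) (hbij : Function.Bijective h) (h0 : h ⟨0, hm1⟩ = 1)
    (n : ℕ) (hn1 : 1 ≤ n) (hnm : 2 * m - 1 ≤ n)
    (Y : ZMod n → H)
    (hY : ∀ j : ZMod n, Y j = if hj : j.val < m then h ⟨j.val, hj⟩ else 1)
    (x y : Wreath H (ZMod n))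
    (hx : x = ⟨fun _ => 1, fun i => i + 1⟩)
    (hy : y = ⟨Y, fun _ => (0 : ZMod n)⟩) :
    y * y = y ∧
    ∀ z ∈ maxSubgroupIn
        (↑(Submonoid.closure ({x, y} : Set (Wreath H (ZMod n))))) y,
      ∃ L : List (Wreath H (ZMod n)),
        (∀ w ∈ L, w ∈ Submonoid.closure ({x, y} : Set (Wreath H (ZMod n)))
          ∧ w * w = w) ∧ L ≠ [] ∧ L.prod = z := by
  have : NeZero n := ⟨by omega⟩
  have hY0 : Y 0 = 1 := by
    rw [hY]
    simp [hm1, h0]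
  have hYneg : ∀ a, Y a = 1 ∨ Y (-a) = 1 := by
    intro a
    by_cases ha : a.val < m
    · by_cases ha0 : a = 0
      · exact Or.inl (ha0 ▸ hY0)
      · right
        rw [hY, dif_neg]
        rw [ZMod.neg_val, if_neg ha0]
        omega
    · exact Or.inl (by rw [hY, dif_neg ha])
  have hyy : y * y = y := by simp [hy, Wreath.mk_mul_mk, hY0]
  refine ⟨hyy, ?_⟩
  rintro z ⟨⟨u, hu, rfl⟩, -⟩
  obtain ⟨L, hL, hprod⟩ := Submonoid.exists_list_of_mem_closure
    (mul_mul_mem_of_mul_pow_mul_mem hyy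
      (Wreath.mul_shift_pow_mul_mem_closure hY0 hYneg hx hy) hu)
  refine ⟨y :: L, ?_, by simp, ?_⟩
  · intro w hw
    rcases List.mem_cons.mp hw with rfl | hw
    · exact ⟨Submonoid.subset_closure (by simp), hyy⟩
    · exact hL w hw
  · rw [List.prod_cons, hprod, ← mul_assoc, ← mul_assoc, hyy]
end

section
/- Let P be a property of finite groups that is invariant under group isomorphism, inherited by subgroups and by quotient groups, closed under finite direct products, and such that for every k ∈ ℕ there exists n ≥ k with P(ℤ/nℤ). Let H be a finite group satisfying P. Then there exists a finite monoid M generated by two elements such that: (i) for every idempotent e ∈ M, the maximal subgroup G_e of M at e satisfies P; (ii) there is an idempotent f in the minimal ideal J of M such that G_f is isomorphic to H; and (iii) J is generated by its idempotents, i.e., every element of J is a product of finitely many idempotents lying in J. -/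
/-- A realization of the subset `A` of a monoid as a finite group satisfying the
property `P`, via a multiplication-preserving bijection. -/
structure GroupRealization (P : ∀ (G : Type) [Group G] [Finite G], Prop)
    {M : Type} [Monoid M] (A : Set M) : Type 1 where
  G : Type
  [grp : Group G]
  [fin : Finite G]
  hP : P G
  ψ : M → G
  bij : Set.BijOn ψ A Set.univ
  map_mul : ∀ x ∈ A, ∀ y ∈ A, ψ (x * y) = ψ x * ψ y

/-- A finite monoid `M` generated by two elements such that: (i) the maximal
subgroup at every idempotent of `M` satisfies `P`; (ii) some idempotent `f` of the
minimal ideal `J` has maximal subgroup isomorphic to `H`; (iii) every element of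
`J` is a product of finitely many idempotents lying in `J`. -/
structure TwoGeneratedWitness (P : ∀ (G : Type) [Group G] [Finite G], Prop)
    (H : Type) [Group H] [Finite H] : Type 1 where
  M : Type
  [mon : Monoid M]
  [fin : Finite M]
  a : M
  b : M
  gen : Submonoid.closure ({a, b} : Set M) = ⊤
  subgroupsP : ∀ e : M, e * e = e → Nonempty (GroupRealization P (maxSubgroup e))
  J : Set M
  minIdeal : IsMinimalIdeal J
  f : M
  f_mem : f ∈ J
  f_idem : f * f = f
  iso : ∃ ψ : M → H, Set.BijOn ψ (maxSubgroup f) Set.univ ∧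
    ∀ x ∈ maxSubgroup f, ∀ y ∈ maxSubgroup f, ψ (x * y) = ψ x * ψ y
  idem_gen : ∀ z ∈ J, ∃ L : List M,
    (∀ w ∈ L, w ∈ J ∧ w * w = w) ∧ L ≠ [] ∧ L.prod = z

/-- The disjoint union of a monoid `C` and the Rees matrix semigroup `C × H × C` with sandwich
matrix `(j, k) ↦ p (j * k)`. -/
inductive ReesExtension {C H : Type} (p : C → H) : Type
  | base (c : C) : ReesExtension p
  | rees (i : C) (h : H) (j : C) : ReesExtension p

namespace ReesExtension

variable {C H : Type}

/-- Multiplication in the Rees extension: `C` acts on the outer coordinates by translation. -/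
protected def mul [Monoid C] [Group H] {p : C → H} : ReesExtension p → ReesExtension p →
    ReesExtension p
  | base c, base d => base (c * d)
  | base c, rees i h j => rees (c * i) h j
  | rees i h j, base c => rees i h (j * c)
  | rees i h j, rees k g l => rees i (h * p (j * k) * g) l

section Monoid

variable [Monoid C] [Group H] {p : C → H}

instance : Mul (ReesExtension p) := ⟨ReesExtension.mul⟩

instance : One (ReesExtension p) := ⟨base 1⟩

@[simp] lemma one_def : (1 : ReesExtension p) = base 1 := rfl

@[simp] lemma base_mul_base (c d : C) : (base c * base d : ReesExtension p) = base (c * d) := rfl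

@[simp] lemma base_mul_rees (c i j : C) (h : H) :
    (base c * rees i h j : ReesExtension p) = rees (c * i) h j := rfl

@[simp] lemma rees_mul_base (c i j : C) (h : H) :
    (rees i h j * base c : ReesExtension p) = rees i h (j * c) := rfl

@[simp] lemma rees_mul_rees (i j k l : C) (h g : H) :
    (rees i h j * rees k g l : ReesExtension p) = rees i (h * p (j * k) * g) l := rfl

instance : Monoid (ReesExtension p) where
  mul_assoc := by rintro (_ | _) (_ | _) (_ | _) <;> simp [mul_assoc]
  one_mul := by rintro (_ | _) <;> simp
  mul_one := by rintro (_ | _) <;> simp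

lemma base_pow (c : C) (k : ℕ) : (base c ^ k : ReesExtension p) = base (c ^ k) := by
  induction k with
  | zero => simp
  | succ k ih => simp [pow_succ, ih]

instance [Finite C] [Finite H] : Finite (ReesExtension p) := by
  let F : C ⊕ (C × H × C) → ReesExtension p := Sum.elim base fun x => rees x.1 x.2.1 x.2.2
  refine Finite.of_surjective F ?_
  rintro (c | ⟨i, h, j⟩)
  · exact ⟨Sum.inl c, rfl⟩
  · exact ⟨Sum.inr (i, h, j), rfl⟩

lemma closure_eq_top (hp : Function.Surjective p) (a : C) (ha : ∀ c : C, ∃ k : ℕ, a ^ k = c) :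
    Submonoid.closure ({base a, rees 1 1 1} : Set (ReesExtension p)) = ⊤ := by
  refine eq_top_iff.2 fun x _ => ?_
  set S := Submonoid.closure ({base a, rees 1 1 1} : Set (ReesExtension p)) with hS
  have hb : rees 1 1 1 ∈ S := Submonoid.subset_closure (by simp)
  have hbase (c : C) : base c ∈ S := by
    obtain ⟨k, rfl⟩ := ha c
    rw [← base_pow]
    exact pow_mem (Submonoid.subset_closure (by simp)) k
  rcases x with c | ⟨i, h, j⟩
  · exact hbase c
  · obtain ⟨c, rfl⟩ := hp h
    have := mul_mem (mul_mem (hbase i) (mul_mem (mul_mem hb (hbase c)) hb)) (hbase j)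
    simpa using this

/-- The Rees matrix part of the extension. -/
def reesPart (p : C → H) : Set (ReesExtension p) := {x | ∃ i h j, x = rees i h j}

lemma isMinimalIdeal_reesPart (hp : p 1 = 1) : IsMinimalIdeal (reesPart p) := by
  refine ⟨⟨⟨rees 1 1 1, 1, 1, 1, rfl⟩, ?_⟩, ?_⟩
  · rintro (c | ⟨k, g, l⟩) _ ⟨i, h, j, rfl⟩
    · exact ⟨⟨_, _, _, rfl⟩, ⟨_, _, _, rfl⟩⟩
    · exact ⟨⟨_, _, _, rfl⟩, ⟨_, _, _, rfl⟩⟩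
  · rintro I ⟨⟨x, hx⟩, hI⟩ _ ⟨i, h, j, rfl⟩
    have hy : rees 1 1 1 * x * rees 1 1 1 ∈ I := (hI _ _ (hI _ _ hx).1).2
    obtain ⟨g, hg⟩ : ∃ g, rees 1 1 1 * x * rees 1 1 1 = (rees 1 g 1 : ReesExtension p) := by
      rcases x with c | ⟨k, g, l⟩ <;> simp
    rw [hg] at hy
    have := (hI (rees 1 1 j) _ (hI (rees i (h * g⁻¹) 1) _ hy).1).2
    simpa [hp] using this

lemma mem_maxSubgroup_rees {i j : C} {g : H} (hg : g * p (j * i) = 1) (x : ReesExtension p) :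
    x ∈ maxSubgroup (rees i g j) ↔ ∃ h, x = rees i h j := by
  have hg' : p (j * i) * g = 1 := mul_eq_one_comm.1 hg
  have key (h : H) : ∃ m : ReesExtension p, rees i h j = rees i g j * m * rees i g j :=
    ⟨rees i h j, by simp [hg, mul_assoc, hg']⟩
  constructor
  · rintro ⟨⟨m, rfl⟩, -⟩
    rcases m with c | ⟨k, h, l⟩ <;> simp
  · rintro ⟨h, rfl⟩
    refine ⟨key h, rees i (g * h⁻¹ * g) j, key _, ?_, ?_⟩
    · have : h * p (j * i) * (g * h⁻¹ * g) = h * (p (j * i) * g) * h⁻¹ * g := by group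
      simp [this, hg']
    · have : g * h⁻¹ * g * p (j * i) * h = g * h⁻¹ * (g * p (j * i)) * h := by group
      simp [this, hg]

lemma exists_maxSubgroup_rees_iso {i j : C} {g : H} (hg : g * p (j * i) = 1) :
    ∃ ψ : ReesExtension p → H, Set.BijOn ψ (maxSubgroup (rees i g j)) Set.univ ∧
      ∀ x ∈ maxSubgroup (rees i g j), ∀ y ∈ maxSubgroup (rees i g j),
        ψ (x * y) = ψ x * ψ y := by
  let ψ : ReesExtension p → H
    | base _ => 1
    | rees _ h _ => h * p (j * i)
  refine ⟨ψ, ⟨fun _ _ => Set.mem_univ _, ?_, ?_⟩, ?_⟩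
  · intro x hx y hy hxy
    obtain ⟨h, rfl⟩ := (mem_maxSubgroup_rees hg x).1 hx
    obtain ⟨k, rfl⟩ := (mem_maxSubgroup_rees hg y).1 hy
    exact congrArg (rees i · j) (mul_right_cancel hxy)
  · intro h _
    exact ⟨rees i (h * (p (j * i))⁻¹) j, (mem_maxSubgroup_rees hg _).2 ⟨_, rfl⟩, by simp [ψ]⟩
  · intro x hx y hy
    obtain ⟨h, rfl⟩ := (mem_maxSubgroup_rees hg x).1 hx
    obtain ⟨k, rfl⟩ := (mem_maxSubgroup_rees hg y).1 hy
    simp [ψ, mul_assoc]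

lemma rees_eq_prod_idempotents (hp1 : p 1 = 1)
    (hp : ∀ h, ∃ x y, p x = 1 ∧ p y = 1 ∧ p (y * x) = h) (z : ReesExtension p)
    (hz : z ∈ reesPart p) :
    ∃ L : List (ReesExtension p), (∀ w ∈ L, w ∈ reesPart p ∧ w * w = w) ∧ L ≠ [] ∧
      L.prod = z := by
  obtain ⟨i, h, j, rfl⟩ := hz
  obtain ⟨x, y, hx, hy, hxy⟩ := hp (p i * h * p j)
  refine ⟨[rees i (p i)⁻¹ 1, rees 1 1 y, rees x 1 1, rees 1 (p j)⁻¹ j], ?_, by simp, ?_⟩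
  · simp [reesPart, hx, hy]
  · simp [hp1, hxy, mul_assoc]

end Monoid

section Group

variable [Group C] [Group H] {p : C → H}

lemma mem_maxSubgroup_one (x : ReesExtension p) :
    x ∈ maxSubgroup (base 1) ↔ ∃ c, x = base c := by
  constructor
  · rintro ⟨-, y, -, hxy, -⟩
    rcases x with c | ⟨i, h, j⟩
    · exact ⟨c, rfl⟩
    · rcases y with c | ⟨k, g, l⟩ <;> simp at hxy
  · rintro ⟨c, rfl⟩
    exact ⟨⟨base c, by simp⟩, base c⁻¹, ⟨base c⁻¹, by simp⟩, by simp, by simp⟩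

lemma exists_maxSubgroup_one_iso :
    ∃ ψ : ReesExtension p → C, Set.BijOn ψ (maxSubgroup (base 1)) Set.univ ∧
      ∀ x ∈ maxSubgroup (base 1), ∀ y ∈ maxSubgroup (base 1), ψ (x * y) = ψ x * ψ y := by
  let ψ : ReesExtension p → C
    | base c => c
    | rees _ _ _ => 1
  refine ⟨ψ, ⟨fun _ _ => Set.mem_univ _, ?_, ?_⟩, ?_⟩
  · intro x hx y hy hxy
    obtain ⟨c, rfl⟩ := (mem_maxSubgroup_one x).1 hx
    obtain ⟨d, rfl⟩ := (mem_maxSubgroup_one y).1 hy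
    exact congrArg base hxy
  · intro c _
    exact ⟨base c, (mem_maxSubgroup_one _).2 ⟨c, rfl⟩, rfl⟩
  · intro x hx y hy
    obtain ⟨c, rfl⟩ := (mem_maxSubgroup_one x).1 hx
    obtain ⟨d, rfl⟩ := (mem_maxSubgroup_one y).1 hy
    rfl

lemma nonempty_groupRealization [Finite C] [Finite H]
    (P : ∀ (G : Type) [Group G] [Finite G], Prop) (hC : P C) (hH : P H)
    (e : ReesExtension p) (he : e * e = e) : Nonempty (GroupRealization P (maxSubgroup e)) := by
  rcases e with c | ⟨i, g, j⟩
  · obtain rfl : c = 1 := by simpa using he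
    obtain ⟨ψ, hψ, hmul⟩ := exists_maxSubgroup_one_iso (p := p)
    exact ⟨⟨C, hC, ψ, hψ, hmul⟩⟩
  · have hg : g * p (j * i) = 1 := by simpa using he
    obtain ⟨ψ, hψ, hmul⟩ := exists_maxSubgroup_rees_iso hg
    exact ⟨⟨H, hH, ψ, hψ, hmul⟩⟩

end Group

end ReesExtension

/-- A large enough cyclic group carries a function to `H` taking every value at a product of two
points where it is trivial. -/
lemma exists_zmod_sandwich (H : Type) [Group H] [Finite H] (n : ℕ)
    (hn : 2 * Nat.card H + 1 ≤ n + 1) :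
    ∃ p : Multiplicative (ZMod (n + 1)) → H, p 1 = 1 ∧
      ∀ h, ∃ x y, p x = 1 ∧ p y = 1 ∧ p (y * x) = h := by
  set m := Nat.card H with hm
  let e : H ≃ Fin m := Finite.equivFin H
  let q : ℕ → H := fun v => if hv : m < v ∧ v - m - 1 < m then e.symm ⟨v - m - 1, hv.2⟩ else 1
  have hq (v : ℕ) (hv : v ≤ m) : q v = 1 := dif_neg fun h => absurd h.1 (by omega)
  refine ⟨fun c => q (ZMod.val c.toAdd), by simp [hq], fun h => ?_⟩
  have hk := (e h).isLt
  refine ⟨.ofAdd (((e h : ℕ) + 1 : ℕ) : ZMod (n + 1)), .ofAdd ((m : ℕ) : ZMod (n + 1)), ?_, ?_, ?_⟩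
  · simp only [toAdd_ofAdd]
    rw [ZMod.val_natCast_of_lt (by omega)]
    exact hq _ (by omega)
  · simp only [toAdd_ofAdd]
    rw [ZMod.val_natCast_of_lt (by omega)]
    exact hq _ le_rfl
  · simp only [toAdd_mul, toAdd_ofAdd]
    rw [← Nat.cast_add, ZMod.val_natCast_of_lt (by omega)]
    simp [q]

/-- Let `P` be an isomorphism-invariant property of finite groups inherited by
subgroups and quotients, closed under finite direct products, and satisfied by
`ℤ/nℤ` for arbitrarily large `n`.  Then every finite group `H` satisfying `P` is
the maximal subgroup of the minimal ideal `J` of some two-generated finite monoid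
all of whose maximal subgroups satisfy `P`, with `J` generated by its
idempotents. -/
theorem exists_two_generated_monoid_with_prescribed_maximal_subgroup
    (P : ∀ (G : Type) [Group G] [Finite G], Prop)
    (hiso : ∀ (G G' : Type) [Group G] [Finite G] [Group G'] [Finite G'],
      (G ≃* G') → P G → P G')
    (hsub : ∀ (G : Type) [Group G] [Finite G] (K : Subgroup G), P G → P K)
    (hquot : ∀ (G : Type) [Group G] [Finite G] (K : Subgroup G) [K.Normal],
      P G → P (G ⧸ K))
    (hprod : ∀ (G G' : Type) [Group G] [Finite G] [Group G'] [Finite G'],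
      P G → P G' → P (G × G'))
    (hcyc : ∀ k : ℕ, ∃ n : ℕ, k ≤ n + 1 ∧ P (Multiplicative (ZMod (n + 1))))
    (H : Type) [Group H] [Finite H] (hH : P H) :
    Nonempty (TwoGeneratedWitness P H) := by
  obtain ⟨n, hn, hC⟩ := hcyc (2 * Nat.card H + 1)
  obtain ⟨p, hp1, hp⟩ := exists_zmod_sandwich H n hn
  have hsurj : Function.Surjective p := fun h =>
    let ⟨x, y, _, _, hxy⟩ := hp h
    ⟨y * x, hxy⟩
  have hgen (c : Multiplicative (ZMod (n + 1))) :
      ∃ k : ℕ, Multiplicative.ofAdd (1 : ZMod (n + 1)) ^ k = c := by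
    refine ⟨ZMod.val c.toAdd, ?_⟩
    rw [← ofAdd_nsmul]
    simp
  exact ⟨{
    M := ReesExtension p
    a := .base (.ofAdd 1)
    b := .rees 1 1 1
    gen := ReesExtension.closure_eq_top hsurj _ hgen
    subgroupsP := ReesExtension.nonempty_groupRealization P hC hH
    J := ReesExtension.reesPart p
    minIdeal := ReesExtension.isMinimalIdeal_reesPart hp1
    f := .rees 1 1 1
    f_mem := ⟨1, 1, 1, rfl⟩
    f_idem := by simp [hp1]
    iso := ReesExtension.exists_maxSubgroup_rees_iso (by simp [hp1])
    idem_gen := ReesExtension.rees_eq_prod_idempotents hp1 hp }⟩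
end

section
/- In this setting, for every word w over the alphabet {1, …, n} and every j ∈ ZMod p, the block entry (η w).1 j ∈ H ≀ (B, T_B) satisfies ᾱ((η w).1 j) = M_w. That is, every block entry of η(w) is an ᾱ-preimage of M_w. -/
/-- Applying a map `φ : H → K` entry-wise to the first component of a wreath
product element; for `φ = α` a group homomorphism this is the map
`ᾱ : H ≀ (B, T_B) → K ≀ (B, T_B)`, `(f, τ) ↦ (α ∘ f, τ)`. -/
def mapW {H K B : Type*} (φ : H → K) (u : Wreath H B) : Wreath K B :=
  ⟨fun b => φ (u.f b), u.t⟩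

theorem mapW_mul {H K B : Type*} [Monoid H] [Monoid K] (φ : H →* K) (u v : Wreath H B) :
    mapW φ (u * v) = mapW φ u * mapW φ v := by
  show Wreath.mk _ _ = Wreath.mk _ _
  congr 1
  funext b
  exact map_mul φ _ _

theorem mapW_one {H K B : Type*} [Monoid H] [Monoid K] (φ : H →* K) :
    mapW φ (1 : Wreath H B) = 1 := by
  show Wreath.mk _ _ = Wreath.mk _ _
  congr 1
  funext b
  exact map_one φ

theorem mapW_mapW_of_rightInverse {H K B : Type*} {φ : H → K} {σ : K → H}
    (hσ : ∀ k, φ (σ k) = k) (u : Wreath K B) : mapW φ (mapW σ u) = u := by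
  show Wreath.mk _ _ = Wreath.mk _ _
  congr 1
  funext b
  exact hσ _

theorem mapW_mk_ker {H K B : Type*} [Group H] [Group K] (φ : H →* K) (ν : B → φ.ker) :
    mapW φ (Wreath.mk (fun b => (ν b : H)) id) = 1 := by
  show Wreath.mk _ _ = Wreath.mk _ _
  congr 1
  funext b
  exact (ν b).2

/-- If every block entry of each generator is a preimage of the corresponding element, then so is
every block entry of each word in the generators. -/
theorem mapW_lift_apply {H K B C ι : Type*} [Monoid H] [Monoid K] (φ : H →* K)
    (x : ι → Wreath (Wreath H B) C) (M : ι → Wreath K B)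
    (h : ∀ i c, mapW φ ((x i).f c) = M i) (w : FreeMonoid ι) (c : C) :
    mapW φ ((FreeMonoid.lift x w).f c) = FreeMonoid.lift M w := by
  induction w using FreeMonoid.inductionOn' generalizing c with
  | one =>
    rw [map_one, map_one]
    exact mapW_one φ
  | of_mul i w ih =>
    rw [map_mul, map_mul, FreeMonoid.lift_eval_of, FreeMonoid.lift_eval_of, ← h i c,
      ← ih ((x i).t c)]
    exact mapW_mul φ _ _

/-- Setup of Lemma 5.?: `α : H ↠ K` a surjective homomorphism of finite groups
with kernel `N` and set-theoretic section `σ`, `B` a nonempty finite set,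
`M_1, …, M_n ∈ K ≀ (B, T_B)` (`n ≥ 2`), `ℓ = |N|^|B|`, `D` an enumeration of
`N^B ⊆ H ≀ (B, T_B)`, `p ≥ ℓ`, and `η` the homomorphism from the free monoid on
`Fin n` to `(H ≀ (B, T_B)) ≀ (ZMod p, T_{ZMod p})` sending letter `i` to `x̃_i`.
Claim: every block entry of `η w` is an `ᾱ`-preimage of `M_w`. -/
theorem block_entries_are_preimages {H K : Type} [Group H] [Finite H]
    [Group K] [Finite K]
    (α : H →* K) (hα : Function.Surjective α)
    (σ : K → H) (hσ : ∀ k : K, α (σ k) = k)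
    (B : Type) [Fintype B] [Nonempty B]
    (n : ℕ) (hn : 2 ≤ n) (Mel : Fin n → Wreath K B)
    (ℓ : ℕ) (hℓ : ℓ = Nat.card α.ker ^ Nat.card B)
    (D : Fin ℓ → (B → α.ker)) (hD : Function.Bijective D)
    (p : ℕ) (hp : 0 < p) (hpl : ℓ ≤ p)
    (xt : Fin n → Wreath (Wreath H B) (ZMod p))
    (hxt0 : xt ⟨0, by omega⟩ =
      ⟨fun _ => mapW σ (Mel ⟨0, by omega⟩), fun i => i + 1⟩)
    (hxti : ∀ i : Fin n, 0 < i.val → xt i =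
      ⟨fun j => if hj : j.val < ℓ then
          Wreath.mk (fun b => ((D ⟨j.val, hj⟩ b : H))) id * mapW σ (Mel i)
        else mapW σ (Mel i),
       fun _ => (0 : ZMod p)⟩) :
    ∀ (w : FreeMonoid (Fin n)) (j : ZMod p),
      mapW (⇑α) ((FreeMonoid.lift xt w).f j) = FreeMonoid.lift Mel w := by
  refine mapW_lift_apply α xt Mel fun i c => ?_
  rcases Nat.eq_zero_or_pos i.val with h0 | hpos
  · have hi : i = ⟨0, by omega⟩ := Fin.ext h0
    rw [hi, hxt0]
    exact mapW_mapW_of_rightInverse hσ _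
  · rw [hxti i hpos]
    dsimp only
    split_ifs with hj
    · rw [mapW_mul, mapW_mk_ker, one_mul, mapW_mapW_of_rightInverse hσ]
    · exact mapW_mapW_of_rightInverse hσ _
end

section
/- Let S be a nonempty compact Hausdorff totally disconnected topological semigroup (with continuous multiplication) which is simple, i.e., whose only ideal is S itself. Then the set E(S) of idempotents of S is nonempty, and the smallest closed subsemigroup T of S containing E(S) is itself a simple semigroup: the only ideal of T is T. -/
/-- A compact Hausdorff semigroup has a right ideal `R` generated by each of its elements. -/
theorem exists_minimal_right_ideal_of_compact
    {S : Type*} [Semigroup S] [TopologicalSpace S] [CompactSpace S] [T2Space S]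
    [Nonempty S] [ContinuousMul S] :
    ∃ R : Set S, R.Nonempty ∧ (∀ x ∈ R, ∀ s : S, x * s ∈ R) ∧
      ∀ a ∈ R, ∀ b ∈ R, ∃ s : S, b = a * s := by
  obtain ⟨R, hR⟩ := zorn_superset
    {C : Set S | IsClosed C ∧ C.Nonempty ∧ ∀ x ∈ C, ∀ s : S, x * s ∈ C} (by
      intro c hc hchain
      rcases c.eq_empty_or_nonempty with rfl | hne
      · exact ⟨Set.univ, ⟨isClosed_univ, Set.univ_nonempty, by simp⟩, by simp⟩
      · refine ⟨⋂₀ c, ⟨isClosed_sInter fun C hC => (hc hC).1, ?_, ?_⟩,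
          fun C hC => Set.sInter_subset_of_mem hC⟩
        · have : Nonempty c := hne.to_subtype
          exact IsCompact.nonempty_sInter_of_directed_nonempty_isCompact_isClosed
            (IsChain.directedOn hchain.symm) (fun C hC => (hc hC).2.1)
            (fun C hC => (hc hC).1.isCompact) (fun C hC => (hc hC).1)
        · exact fun x hx s C hC => (hc hC).2.2 x (hx C hC) s)
  obtain ⟨-, hne, hmul⟩ := hR.prop
  refine ⟨R, hne, hmul, fun a ha b hb => ?_⟩
  have hmem : Set.range (a * ·) ∈
      {C : Set S | IsClosed C ∧ C.Nonempty ∧ ∀ x ∈ C, ∀ s : S, x * s ∈ C} := by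
    refine ⟨(isCompact_range (continuous_const_mul a)).isClosed, Set.range_nonempty _, ?_⟩
    rintro _ ⟨u, rfl⟩ s
    exact ⟨u * s, (mul_assoc a u s).symm⟩
  have hsub : Set.range (a * ·) ⊆ R := by
    rintro _ ⟨u, rfl⟩
    exact hmul a ha u
  obtain ⟨s, hs⟩ := hR.le_of_le hmem hsub hb
  exact ⟨s, hs.symm⟩

/-- In a compact Hausdorff simple semigroup, every principal right ideal `t * S` is minimal
and contains `t`. -/
theorem exists_eq_mul_mul_of_compact_simple
    {S : Type*} [Semigroup S] [TopologicalSpace S] [CompactSpace S] [T2Space S]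
    [Nonempty S] [ContinuousMul S]
    (hsimple : ∀ I : Set S, I.Nonempty →
      (∀ s : S, ∀ x ∈ I, s * x ∈ I ∧ x * s ∈ I) → I = Set.univ) (t u : S) :
    ∃ v : S, t = t * u * v := by
  obtain ⟨R, ⟨r, hr⟩, hmul, hmin⟩ := exists_minimal_right_ideal_of_compact (S := S)
  have huniv : {x : S | ∃ s, ∃ a ∈ R, x = s * a} = Set.univ := by
    refine hsimple _ ⟨r * r, r, r, hr, rfl⟩ ?_
    rintro s _ ⟨p, a, ha, rfl⟩
    exact ⟨⟨s * p, a, ha, (mul_assoc s p a).symm⟩, ⟨p, a * s, hmul a ha s, mul_assoc p a s⟩⟩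
  obtain ⟨p, a, ha, rfl⟩ : t ∈ {x : S | ∃ s, ∃ a ∈ R, x = s * a} := huniv ▸ Set.mem_univ t
  obtain ⟨v, hv⟩ := hmin (a * u) (hmul a ha u) a ha
  exact ⟨v, by rw [mul_assoc p a u, mul_assoc p, ← hv]⟩

/-- Every closed subsemigroup of a compact Hausdorff simple semigroup is simple. -/
theorem ideal_eq_of_isClosed_of_compact_simple
    {S : Type*} [Semigroup S] [TopologicalSpace S] [CompactSpace S] [T2Space S]
    [Nonempty S] [ContinuousMul S]
    (hsimple : ∀ I : Set S, I.Nonempty →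
      (∀ s : S, ∀ x ∈ I, s * x ∈ I ∧ x * s ∈ I) → I = Set.univ)
    {T I : Set S} (hT : IsClosed T) (hmul : ∀ x ∈ T, ∀ y ∈ T, x * y ∈ T)
    (hIT : I ⊆ T) (hne : I.Nonempty) (hI : ∀ t ∈ T, ∀ x ∈ I, t * x ∈ I ∧ x * t ∈ I) :
    I = T := by
  refine hIT.antisymm fun t ht => ?_
  obtain ⟨x, hx⟩ := hne
  obtain ⟨_, ⟨s, hs, rfl⟩, he⟩ := exists_idempotent_in_compact_subsemigroup
    (fun r : S => continuous_mul_const r) ((t * x * ·) '' T) ⟨_, t, ht, rfl⟩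
    (hT.isCompact.image (continuous_const_mul _)) (by
      rintro _ ⟨p, hp, rfl⟩ _ ⟨q, hq, rfl⟩
      exact ⟨p * (t * x * q), hmul _ hp _ (hmul _ (hmul _ ht _ (hIT hx)) _ hq),
        (mul_assoc (t * x) p (t * x * q)).symm⟩)
  obtain ⟨v, hv⟩ := exists_eq_mul_mul_of_compact_simple hsimple t (x * s)
  have het : t * x * s * t = t := by
    have hv' : t = t * x * s * v := by rw [mul_assoc t x s]; exact hv
    calc t * x * s * t = t * x * s * (t * x * s * v) := congrArg (t * x * s * ·) hv'
      _ = t * x * s * v := by rw [← mul_assoc (t * x * s) (t * x * s) v]; exact congrArg (· * v) he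
      _ = t := hv'.symm
  exact het ▸ (hI t ht _ (hI s hs _ (hI t ht x hx).1).2).2


/-- Let `S` be a nonempty compact Hausdorff totally disconnected topological
semigroup which is simple (its only ideal — nonempty subset closed under left
and right multiplication by all of `S` — is `S` itself).  Then `S` has an
idempotent, and the smallest closed subsemigroup `T` containing all idempotents
of `S` is itself simple: the only ideal of `T` is `T`. -/
theorem closed_subsemigroup_generated_by_idempotents_simple
    {S : Type*} [Semigroup S] [TopologicalSpace S] [CompactSpace S] [T2Space S]
    [TotallyDisconnectedSpace S] [Nonempty S] [ContinuousMul S]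
    (hsimple : ∀ I : Set S, I.Nonempty →
      (∀ s : S, ∀ x ∈ I, s * x ∈ I ∧ x * s ∈ I) → I = Set.univ) :
    {e : S | e * e = e}.Nonempty ∧
    ∀ I : Set S,
      I ⊆ ⋂₀ {C : Set S | IsClosed C ∧ (∀ x ∈ C, ∀ y ∈ C, x * y ∈ C) ∧
            {e : S | e * e = e} ⊆ C} →
      I.Nonempty →
      (∀ t ∈ ⋂₀ {C : Set S | IsClosed C ∧ (∀ x ∈ C, ∀ y ∈ C, x * y ∈ C) ∧
            {e : S | e * e = e} ⊆ C},
        ∀ x ∈ I, t * x ∈ I ∧ x * t ∈ I) →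
      I = ⋂₀ {C : Set S | IsClosed C ∧ (∀ x ∈ C, ∀ y ∈ C, x * y ∈ C) ∧
            {e : S | e * e = e} ⊆ C} := by
  refine ⟨exists_idempotent_of_compact_t2_of_continuous_mul_left continuous_mul_const,
    fun I hIT hne hI => ideal_eq_of_isClosed_of_compact_simple hsimple
      (isClosed_sInter fun C hC => hC.1) ?_ hIT hne hI⟩
  exact fun x hx y hy C hC => hC.2.1 x (hx C hC) y (hy C hC)
end
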